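/- arXiv:0811.2259 — 2 statements merged into one kernel-verified Lean document; each statement's English description precedes it below -/
import Mathlib

section
/- If T = [[T₁, W],[Wᵀ, T₂]] is a positive definite rational symmetric matrix and w(T) = w(T₁) + w(T₂), then W = 0. Conversely, if W = 0 then w(T) = w(T₁) + w(T₂). -/
open Matrix

/-- The quadratic form `uᵀ s u` of an integer vector `u`, valued in `ℝ`. -/
noncomputable def quadForm {n : Type*} [Fintype n] (s : Matrix n n ℝ) (u : n → ℤ) : ℝ :=
  (fun i => (u i : ℝ)) ⬝ᵥ s.mulVec (fun i => (u i : ℝ))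

/-- The minimum function `m(s) = inf_{u ∈ ℤ^n \ {0}} uᵀ s u`. -/
noncomputable def minFun {n : Type*} [Fintype n] (s : Matrix n n ℝ) : ℝ :=
  sInf {x : ℝ | ∃ u : n → ℤ, u ≠ 0 ∧ x = quadForm s u}

/-- The dyadic trace `w(s) = inf_{u pos. def.} ⟨u,s⟩ / m(u)` with `⟨A,B⟩ = tr(AB)`. -/
noncomputable def dyadicTrace {n : Type*} [Fintype n] (s : Matrix n n ℝ) : ℝ :=
  sInf {x : ℝ | ∃ u : Matrix n n ℝ, u.PosDef ∧ x = (u * s).trace / minFun u}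

/-- A matrix has rational entries. -/
def RationalEntries {n : Type*} (s : Matrix n n ℝ) : Prop :=
  ∀ i j, ∃ q : ℚ, s i j = (q : ℝ)

open Filter Topology

/-- A positive definite form taking values at least `1` at all nonzero integer vectors. -/
def IsAdmissible {n : Type*} [Fintype n] (u : Matrix n n ℝ) : Prop :=
  u.PosDef ∧ ∀ v : n → ℤ, v ≠ 0 → 1 ≤ quadForm u v

section

variable {n : Type*} [Fintype n]

omit [Fintype n] in
lemma intCast_vec_ne_zero {v : n → ℤ} (hv : v ≠ 0) : (fun i => (v i : ℝ)) ≠ 0 := by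
  contrapose! hv
  ext i
  simpa using congrFun hv i

lemma quadForm_pos {u : Matrix n n ℝ} (hu : u.PosDef) {v : n → ℤ} (hv : v ≠ 0) :
    0 < quadForm u v := by
  simpa [quadForm] using hu.dotProduct_mulVec_pos (intCast_vec_ne_zero hv)

lemma continuous_dotProduct_mulVec_self (N : Matrix n n ℝ) :
    Continuous fun x : n → ℝ => x ⬝ᵥ N *ᵥ x :=
  Continuous.dotProduct continuous_id (Continuous.matrix_mulVec continuous_const continuous_id)

/-- Every quadratic form is dominated by a multiple of a given positive definite one. -/
lemma exists_abs_dotProduct_mulVec_le {M : Matrix n n ℝ} (hM : M.PosDef) (N : Matrix n n ℝ) :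
    ∃ C : ℝ, 0 < C ∧ ∀ x : n → ℝ, |x ⬝ᵥ N *ᵥ x| ≤ C * (x ⬝ᵥ M *ᵥ x) := by
  have hpos : ∀ x : n → ℝ, x ≠ 0 → 0 < x ⬝ᵥ M *ᵥ x := fun x hx => by
    simpa using hM.dotProduct_mulVec_pos hx
  have hne : ∀ x ∈ Metric.sphere (0 : n → ℝ) 1, x ≠ 0 := fun x hx =>
    ne_zero_of_mem_unit_sphere (⟨x, hx⟩ : Metric.sphere (0 : n → ℝ) 1)
  have hcont : ContinuousOn (fun x : n → ℝ => |x ⬝ᵥ N *ᵥ x| / (x ⬝ᵥ M *ᵥ x))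
      (Metric.sphere 0 1) :=
    (continuous_dotProduct_mulVec_self N).abs.continuousOn.div
      (continuous_dotProduct_mulVec_self M).continuousOn fun x hx => (hpos x (hne x hx)).ne'
  obtain ⟨C, hC⟩ := (isCompact_sphere (0 : n → ℝ) 1).bddAbove_image hcont
  refine ⟨max C 1, by positivity, fun x => ?_⟩
  rcases eq_or_ne x 0 with rfl | hx
  · simp
  have hxn : 0 < ‖x‖ := norm_pos_iff.mpr hx
  have hmem : ‖x‖⁻¹ • x ∈ Metric.sphere (0 : n → ℝ) 1 := by
    rw [mem_sphere_zero_iff_norm, norm_smul, norm_inv, norm_norm, inv_mul_cancel₀ hxn.ne']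
  have h := hC (Set.mem_image_of_mem _ hmem)
  have hratio : |x ⬝ᵥ N *ᵥ x| / (x ⬝ᵥ M *ᵥ x) ≤ C := by
    refine le_of_eq_of_le ?_ h
    simp only [mulVec_smul, dotProduct_smul, smul_dotProduct, smul_eq_mul, abs_mul, abs_inv,
      abs_norm]
    field_simp
  rw [div_le_iff₀ (hpos x hx)] at hratio
  exact hratio.trans (mul_le_mul_of_nonneg_right (le_max_left _ _) (hpos x hx).le)

lemma minFun_le {u : Matrix n n ℝ} (hu : u.PosDef) {v : n → ℤ} (hv : v ≠ 0) :
    minFun u ≤ quadForm u v := by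
  refine csInf_le ⟨0, ?_⟩ ⟨v, hv, rfl⟩
  rintro _ ⟨w, hw, rfl⟩
  exact (quadForm_pos hu hw).le

lemma le_minFun [Nonempty n] {u : Matrix n n ℝ} {c : ℝ}
    (h : ∀ v : n → ℤ, v ≠ 0 → c ≤ quadForm u v) : c ≤ minFun u := by
  refine le_csInf ⟨_, 1, one_ne_zero, rfl⟩ ?_
  rintro _ ⟨v, hv, rfl⟩
  exact h v hv

lemma minFun_pos [Nonempty n] {u : Matrix n n ℝ} (hu : u.PosDef) : 0 < minFun u := by
  classical
  obtain ⟨C, hC, h⟩ := exists_abs_dotProduct_mulVec_le hu 1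
  refine lt_of_lt_of_le (inv_pos.mpr hC) (le_minFun fun v hv => ?_)
  obtain ⟨i, hi⟩ := Function.ne_iff.mp hv
  have h1 : (1 : ℝ) ≤ ∑ j, (v j : ℝ) * v j := by
    refine le_trans ?_ (Finset.single_le_sum (f := fun j => (v j : ℝ) * v j)
      (fun j _ => mul_self_nonneg _) (Finset.mem_univ i))
    have : 0 < v i * v i := mul_self_pos.mpr hi
    exact_mod_cast this
  have h2 := h fun j => (v j : ℝ)
  rw [one_mulVec] at h2
  rw [inv_le_iff_one_le_mul₀' hC]
  exact h1.trans ((le_abs_self _).trans h2)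

lemma trace_mul_nonneg {u T : Matrix n n ℝ} (hu : u.PosSemidef) (hT : T.PosSemidef) :
    0 ≤ (u * T).trace := by
  classical
  open scoped MatrixOrder in
  obtain ⟨B, rfl⟩ := CStarAlgebra.nonneg_iff_eq_star_mul_self.mp hT.nonneg
  rw [← mul_assoc, trace_mul_comm, ← mul_assoc]
  exact (hu.mul_mul_conjTranspose_same B).trace_nonneg

/-- A positive semidefinite form that is at least `1` at all nonzero integer vectors
is positive definite. -/
lemma posDef_of_one_le_quadForm {u : Matrix n n ℝ} (hu : u.PosSemidef)
    (h : ∀ v : n → ℤ, v ≠ 0 → 1 ≤ quadForm u v) : u.PosDef := by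
  refine .of_dotProduct_mulVec_pos hu.1 fun x hx => ?_
  refine (hu.dotProduct_mulVec_nonneg x).lt_of_ne fun h0 => ?_
  have hux : u *ᵥ x = 0 := (hu.dotProduct_mulVec_zero_iff x).mp h0.symm
  obtain ⟨i, hi⟩ := Function.ne_iff.mp hx
  set y : n → ℝ := (x i)⁻¹ • x with hy
  have huy : u *ᵥ y = 0 := by rw [hy, mulVec_smul, hux, smul_zero]
  have hyi : y i = 1 := by simpa [hy] using inv_mul_cancel₀ hi
  set f : ℕ → n → ℝ := fun k j => Int.fract (k * y j) with hf
  obtain ⟨a, -, φ, hφ, hlim⟩ :=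
    (isCompact_univ_pi fun _ : n => isCompact_Icc (a := (0 : ℝ)) (b := 1)).tendsto_subseq
      (x := f) fun k j _ => ⟨Int.fract_nonneg _, (Int.fract_lt_one _).le⟩
  have hd : Tendsto (fun k => f (φ (k + 1)) - f (φ k)) atTop (𝓝 0) := by
    simpa using (hlim.comp (tendsto_add_atTop_nat 1)).sub hlim
  have hq := ((continuous_dotProduct_mulVec_self u).tendsto 0).comp hd
  rw [zero_dotProduct] at hq
  obtain ⟨k, hk⟩ := (hq.eventually (gt_mem_nhds one_pos)).exists
  simp only [Function.comp_apply] at hk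
  set d := f (φ (k + 1)) - f (φ k) with hdd
  set N : ℝ := (φ (k + 1) : ℝ) - φ k with hN
  let v : n → ℤ := fun j => ⌊(φ (k + 1) : ℝ) * y j⌋ - ⌊(φ k : ℝ) * y j⌋
  have hvd : (fun j => (v j : ℝ)) = N • y - d := by
    ext j
    simp only [v, hdd, hf, hN, Int.fract, Pi.sub_apply, Pi.smul_apply, smul_eq_mul, Int.cast_sub]
    ring
  have hv : v ≠ 0 := by
    intro h0
    have h1 : v i = 0 := congrFun h0 i
    simp only [v, hyi, mul_one, Int.floor_natCast] at h1
    have := hφ (Nat.lt_succ_self k)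
    simp only [Nat.succ_eq_add_one] at this
    lia
  have hval : quadForm u v = d ⬝ᵥ u *ᵥ d := by
    have hsymm : uᵀ = u := by simpa using hu.1.eq
    have hyd : y ⬝ᵥ u *ᵥ d = 0 := by
      rw [dotProduct_mulVec, ← mulVec_transpose, hsymm, huy, zero_dotProduct]
    rw [quadForm, hvd, mulVec_sub, mulVec_smul, huy]
    simp [sub_dotProduct, hyd]
  exact absurd (h v hv) (by rw [hval]; exact not_le.mpr hk)

lemma IsAdmissible.one_le_minFun [Nonempty n] {u : Matrix n n ℝ} (hu : IsAdmissible u) :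
    1 ≤ minFun u := le_minFun hu.2

lemma quadForm_smul (c : ℝ) (u : Matrix n n ℝ) (v : n → ℤ) :
    quadForm (c • u) v = c * quadForm u v := by
  simp [quadForm, smul_mulVec, dotProduct_smul]

lemma isAdmissible_inv_minFun_smul [Nonempty n] {u : Matrix n n ℝ} (hu : u.PosDef) :
    IsAdmissible ((minFun u)⁻¹ • u) := by
  refine ⟨hu.smul (inv_pos.mpr (minFun_pos hu)), fun v hv => ?_⟩
  rw [quadForm_smul, inv_mul_eq_div, one_le_div (minFun_pos hu)]
  exact minFun_le hu hv

lemma continuous_quadForm (v : n → ℤ) : Continuous fun u : Matrix n n ℝ => quadForm u v :=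
  Continuous.dotProduct continuous_const (Continuous.matrix_mulVec continuous_id continuous_const)

lemma isClosed_setOf_posSemidef : IsClosed {u : Matrix n n ℝ | u.PosSemidef} := by
  simp only [posSemidef_iff_dotProduct_mulVec, Matrix.IsHermitian, Set.ofPred_and, Set.ofPred_forall]
  refine (isClosed_eq (by fun_prop) continuous_id).inter (isClosed_iInter fun x => ?_)
  exact isClosed_le continuous_const
    (Continuous.dotProduct continuous_const
      (Continuous.matrix_mulVec continuous_id continuous_const))

lemma Matrix.PosSemidef.abs_apply_le_trace {M : Matrix n n ℝ} (hM : M.PosSemidef) (i j : n) :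
    |M i j| ≤ M.trace := by
  classical
  have hdiag : ∀ k, M k k ≤ M.trace := fun k =>
    Finset.single_le_sum (f := fun k => M k k) (fun _ _ => hM.diag_nonneg) (Finset.mem_univ k)
  have hsymm : M j i = M i j := by simpa using hM.1.apply i j
  have hplus := hM.dotProduct_mulVec_nonneg (Pi.single i 1 + Pi.single j 1)
  have hminus := hM.dotProduct_mulVec_nonneg (Pi.single i 1 - Pi.single j 1)
  simp [mulVec_add, mulVec_sub, add_dotProduct, sub_dotProduct, hsymm] at hplus hminus
  have := hdiag i
  have := hdiag j
  rw [abs_le]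
  constructor <;> linarith

lemma isCompact_admissible_trace_le {T : Matrix n n ℝ} (hT : T.PosDef) (c : ℝ) :
    IsCompact {u : Matrix n n ℝ | IsAdmissible u ∧ (u * T).trace ≤ c} := by
  classical
  open scoped MatrixOrder in
  obtain ⟨B, rfl⟩ := CStarAlgebra.nonneg_iff_eq_star_mul_self.mp hT.posSemidef.nonneg
  have hB : IsUnit B.det := by
    have := (isUnit_iff_isUnit_det _).mp hT.isUnit
    rw [det_mul] at this
    exact isUnit_of_mul_isUnit_right this
  have hbox : IsCompact {M : Matrix n n ℝ | ∀ i j, M i j ∈ Set.Icc (-c) c} :=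
    isCompact_Icc.matrix
  have himage := hbox.image (f := fun M => B⁻¹ * M * (B⁻¹)ᴴ) (by fun_prop)
  refine himage.of_isClosed_subset ?_ ?_
  · have : {u : Matrix n n ℝ | IsAdmissible u ∧ (u * (star B * B)).trace ≤ c} =
        {u | u.PosSemidef} ∩ (⋂ v : n → ℤ, ⋂ _ : v ≠ 0, {u | 1 ≤ quadForm u v}) ∩
          {u | (u * (star B * B)).trace ≤ c} := by
      ext u
      simp only [Set.mem_ofPred_eq, Set.mem_inter_iff, Set.mem_iInter, IsAdmissible]
      exact ⟨fun h => ⟨⟨h.1.1.posSemidef, h.1.2⟩, h.2⟩,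
        fun h => ⟨⟨posDef_of_one_le_quadForm h.1.1 h.1.2, h.1.2⟩, h.2⟩⟩
    rw [this]
    refine (isClosed_setOf_posSemidef.inter ?_).inter (isClosed_le (by fun_prop) continuous_const)
    exact isClosed_iInter fun v => isClosed_iInter fun _ =>
      isClosed_le continuous_const (continuous_quadForm v)
  · rintro u ⟨hu, hc⟩
    refine ⟨B * u * Bᴴ, fun i j => ?_, ?_⟩
    · have hM := hu.1.posSemidef.mul_mul_conjTranspose_same B
      have htr : (B * u * Bᴴ).trace ≤ c := by
        rwa [← mul_assoc, trace_mul_comm, ← mul_assoc] at hc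
      exact abs_le.mp ((hM.abs_apply_le_trace i j).trans htr)
    · have h1 : Bᴴ * (B⁻¹)ᴴ = 1 := by
        rw [← conjTranspose_mul, nonsing_inv_mul _ hB, conjTranspose_one]
      calc B⁻¹ * (B * u * Bᴴ) * (B⁻¹)ᴴ = (B⁻¹ * B) * u * (Bᴴ * (B⁻¹)ᴴ) := by
            simp only [mul_assoc]
        _ = u := by rw [h1, nonsing_inv_mul _ hB, one_mul, mul_one]

lemma dyadicTrace_le_trace [Nonempty n] {T u : Matrix n n ℝ} (hT : T.PosSemidef)
    (hu : IsAdmissible u) : dyadicTrace T ≤ (u * T).trace := by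
  refine le_trans ?_ (div_le_self (trace_mul_nonneg hu.1.posSemidef hT) hu.one_le_minFun)
  refine csInf_le ⟨0, ?_⟩ ⟨u, hu.1, rfl⟩
  rintro _ ⟨u', hu', rfl⟩
  exact div_nonneg (trace_mul_nonneg hu'.posSemidef hT) (minFun_pos hu').le

/-- The infimum defining the dyadic trace of a positive definite matrix is attained. -/
lemma exists_isAdmissible_trace_eq [Nonempty n] {T : Matrix n n ℝ} (hT : T.PosDef) :
    ∃ u, IsAdmissible u ∧ (u * T).trace = dyadicTrace T := by
  classical
  have hu₀ := isAdmissible_inv_minFun_smul (Matrix.PosDef.one (n := n) (R := ℝ))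
  set u₀ := (minFun (1 : Matrix n n ℝ))⁻¹ • (1 : Matrix n n ℝ)
  obtain ⟨u, ⟨hu, huc⟩, hmin⟩ :=
    (isCompact_admissible_trace_le hT (u₀ * T).trace).exists_isMinOn
      (f := fun u => (u * T).trace)
      ⟨u₀, hu₀, le_rfl⟩ (by fun_prop)
  refine ⟨u, hu, le_antisymm ?_ (dyadicTrace_le_trace hT.posSemidef hu)⟩
  refine le_csInf ⟨_, 1, .one, rfl⟩ ?_
  rintro _ ⟨v, hv, rfl⟩
  have heq : (v * T).trace / minFun v = (((minFun v)⁻¹ • v) * T).trace := by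
    rw [smul_mul, trace_smul, smul_eq_mul, inv_mul_eq_div]
  rw [heq]
  have hadm := isAdmissible_inv_minFun_smul hv
  by_cases hle : (((minFun v)⁻¹ • v) * T).trace ≤ (u₀ * T).trace
  · exact hmin ⟨hadm, hle⟩
  · exact huc.trans (not_le.mp hle).le

end

section blocks

variable {m n : Type*} [Fintype m] [Fintype n]

lemma trace_fromBlocks_eq (A : Matrix m m ℝ) (B : Matrix m n ℝ) (C : Matrix n m ℝ)
    (D : Matrix n n ℝ) : (fromBlocks A B C D).trace = A.trace + D.trace := by
  simp [trace, Fintype.sum_sum_type]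

lemma trace_fromBlocks_mul_fromBlocks (A T₁ : Matrix m m ℝ) (D T₂ : Matrix n n ℝ)
    (X W : Matrix m n ℝ) :
    (fromBlocks A X Xᵀ D * fromBlocks T₁ W Wᵀ T₂).trace =
      (A * T₁).trace + (D * T₂).trace + 2 * (X * Wᵀ).trace := by
  have : (Xᵀ * W).trace = (X * Wᵀ).trace := by
    rw [← trace_transpose, transpose_mul, transpose_transpose, trace_mul_comm]
  rw [fromBlocks_multiply, trace_fromBlocks_eq, trace_add, trace_add, this]
  ring

lemma elim_dotProduct_fromBlocks_mulVec (A : Matrix m m ℝ) (D : Matrix n n ℝ) (X : Matrix m n ℝ)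
    (a : m → ℝ) (b : n → ℝ) :
    Sum.elim a b ⬝ᵥ fromBlocks A X Xᵀ D *ᵥ Sum.elim a b =
      a ⬝ᵥ A *ᵥ a + b ⬝ᵥ D *ᵥ b + 2 * (a ⬝ᵥ X *ᵥ b) := by
  have : b ⬝ᵥ Xᵀ *ᵥ a = a ⬝ᵥ X *ᵥ b := by
    rw [dotProduct_mulVec, vecMul_transpose, dotProduct_comm]
  rw [fromBlocks_mulVec]
  simp [sumElim_dotProduct_sumElim, dotProduct_add, this]
  ring

lemma quadForm_fromBlocks (A : Matrix m m ℝ) (D : Matrix n n ℝ) (X : Matrix m n ℝ)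
    (v : m ⊕ n → ℤ) :
    quadForm (fromBlocks A X Xᵀ D) v = quadForm A (v ∘ Sum.inl) + quadForm D (v ∘ Sum.inr) +
      2 * ((fun i => (v (Sum.inl i) : ℝ)) ⬝ᵥ X *ᵥ fun j => (v (Sum.inr j) : ℝ)) := by
  have := elim_dotProduct_fromBlocks_mulVec A D X (fun i => (v (Sum.inl i) : ℝ))
    (fun j => (v (Sum.inr j) : ℝ))
  have hv : (Sum.elim (fun i => (v (Sum.inl i) : ℝ)) fun j => (v (Sum.inr j) : ℝ)) =
      fun k => (v k : ℝ) := by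
    ext (i | j) <;> rfl
  rw [hv] at this
  exact this

lemma quadForm_zero (A : Matrix m m ℝ) : quadForm A 0 = 0 := by
  simp [quadForm, dotProduct]

/-- Off-diagonal blocks that are small compared to admissible diagonal blocks
preserve admissibility. -/
lemma IsAdmissible.fromBlocks {A : Matrix m m ℝ} {D : Matrix n n ℝ} (hA : IsAdmissible A)
    (hD : IsAdmissible D) {X : Matrix m n ℝ}
    (hX : ∀ a b, |2 * (a ⬝ᵥ X *ᵥ b)| ≤ 1 / 2 * (a ⬝ᵥ A *ᵥ a + b ⬝ᵥ D *ᵥ b)) :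
    IsAdmissible (fromBlocks A X Xᵀ D) := by
  refine ⟨.of_dotProduct_mulVec_pos ?_ fun x hx => ?_, fun v hv => ?_⟩
  · exact IsHermitian.fromBlocks hA.1.1 (by simp) hD.1.1
  · obtain ⟨a, b, rfl⟩ : ∃ a b, x = Sum.elim a b := ⟨x ∘ Sum.inl, x ∘ Sum.inr, by simp⟩
    rw [star_trivial, elim_dotProduct_fromBlocks_mulVec]
    have h := (abs_le.mp (hX a b)).1
    have ha : 0 ≤ a ⬝ᵥ A *ᵥ a := by simpa using hA.1.posSemidef.dotProduct_mulVec_nonneg a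
    have hb : 0 ≤ b ⬝ᵥ D *ᵥ b := by simpa using hD.1.posSemidef.dotProduct_mulVec_nonneg b
    rcases eq_or_ne a 0 with rfl | ha0
    · have hb0 : b ≠ 0 := by
        rintro rfl
        exact hx (by ext (i | j) <;> rfl)
      have : 0 < b ⬝ᵥ D *ᵥ b := by simpa using hD.1.dotProduct_mulVec_pos hb0
      linarith
    · have : 0 < a ⬝ᵥ A *ᵥ a := by simpa using hA.1.dotProduct_mulVec_pos ha0
      linarith
  · rw [quadForm_fromBlocks]
    have h := (abs_le.mp (hX (fun i => (v (Sum.inl i) : ℝ)) fun j => (v (Sum.inr j) : ℝ))).1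
    change -(1 / 2 * (quadForm A (v ∘ Sum.inl) + quadForm D (v ∘ Sum.inr))) ≤ _ at h
    by_cases ha : v ∘ Sum.inl = 0
    · have hb : v ∘ Sum.inr ≠ 0 := by
        intro hb
        refine hv (funext ?_)
        rintro (i | j)
        exacts [congrFun ha i, congrFun hb j]
      have hz : (fun i => (v (Sum.inl i) : ℝ)) = 0 := by
        ext i
        simpa using congrFun ha i
      rw [hz, zero_dotProduct, ha, quadForm_zero]
      linarith [hD.2 _ hb]
    · by_cases hb : v ∘ Sum.inr = 0
      · have hz : (fun i => (v (Sum.inr i) : ℝ)) = 0 := by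
          ext i
          simpa using congrFun hb i
        rw [hz, mulVec_zero, dotProduct_zero, hb, quadForm_zero]
        linarith [hA.2 _ ha]
      · linarith [hA.2 _ ha, hD.2 _ hb]

lemma IsAdmissible.fromBlocks_zero {A : Matrix m m ℝ} {D : Matrix n n ℝ} (hA : IsAdmissible A)
    (hD : IsAdmissible D) : IsAdmissible (Matrix.fromBlocks A 0 0ᵀ D) := by
  refine hA.fromBlocks hD fun a b => ?_
  have ha := hA.1.posSemidef.dotProduct_mulVec_nonneg a
  have hb := hD.1.posSemidef.dotProduct_mulVec_nonneg b
  rw [star_trivial] at ha hb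
  rw [zero_mulVec, dotProduct_zero, mul_zero, abs_zero]
  positivity

lemma IsAdmissible.submatrix {u : Matrix n n ℝ} (hu : IsAdmissible u) {e : m → n}
    (he : Function.Injective e) : IsAdmissible (u.submatrix e e) := by
  classical
  refine ⟨hu.1.submatrix he, fun v hv => ?_⟩
  have hext : ∀ i, Function.extend e v 0 (e i) = v i := fun i => he.extend_apply v 0 i
  have hne : Function.extend e v 0 ≠ 0 := by
    contrapose! hv
    ext i
    rw [← hext i, hv, Pi.zero_apply, Pi.zero_apply]
  have hsum : ∀ g : n → ℝ, ∑ k, ((Function.extend e v 0 k : ℤ) : ℝ) * g k =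
      ∑ i, (v i : ℝ) * g (e i) := fun g => by
    rw [← Finset.sum_subset (Finset.subset_univ (Finset.univ.image e)),
      Finset.sum_image fun _ _ _ _ h => he h]
    · simp only [hext]
    · intro k _ hk
      rw [Function.extend_apply' _ _ _ (by simpa using hk)]
      simp
  refine (hu.2 _ hne).trans_eq ?_
  simp only [quadForm, dotProduct, mulVec, submatrix_apply]
  rw [hsum]
  simp only [mul_comm (u _ _), hsum]

variable [Nonempty m] [Nonempty n]

lemma dyadicTrace_fromBlocks_zero {T₁ : Matrix m m ℝ} {T₂ : Matrix n n ℝ} (hT₁ : T₁.PosDef)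
    (hT₂ : T₂.PosDef) (hT : (fromBlocks T₁ 0 0ᵀ T₂).PosDef) :
    dyadicTrace (fromBlocks T₁ 0 0ᵀ T₂) = dyadicTrace T₁ + dyadicTrace T₂ := by
  apply le_antisymm
  · obtain ⟨A, hA, hA'⟩ := exists_isAdmissible_trace_eq hT₁
    obtain ⟨D, hD, hD'⟩ := exists_isAdmissible_trace_eq hT₂
    refine (dyadicTrace_le_trace hT.posSemidef (hA.fromBlocks_zero hD)).trans_eq ?_
    rw [trace_fromBlocks_mul_fromBlocks, hA', hD']
    simp
  · obtain ⟨u, hu, hu'⟩ := exists_isAdmissible_trace_eq hT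
    have h₁ := dyadicTrace_le_trace hT₁.posSemidef (hu.submatrix Sum.inl_injective)
    have h₂ := dyadicTrace_le_trace hT₂.posSemidef (hu.submatrix Sum.inr_injective)
    have htr : (u * fromBlocks T₁ 0 0ᵀ T₂).trace =
        (u.submatrix Sum.inl Sum.inl * T₁).trace + (u.submatrix Sum.inr Sum.inr * T₂).trace := by
      conv_lhs => rw [← fromBlocks_toBlocks u, fromBlocks_multiply, trace_fromBlocks_eq]
      simp only [transpose_zero, Matrix.mul_zero, add_zero, zero_add]
      rfl
    linarith

lemma eq_zero_of_dyadicTrace_fromBlocks_eq {T₁ : Matrix m m ℝ} {T₂ : Matrix n n ℝ}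
    {W : Matrix m n ℝ} (hT₁ : T₁.PosDef) (hT₂ : T₂.PosDef) (hT : (fromBlocks T₁ W Wᵀ T₂).PosDef)
    (h : dyadicTrace (fromBlocks T₁ W Wᵀ T₂) = dyadicTrace T₁ + dyadicTrace T₂) : W = 0 := by
  obtain ⟨A, hA, hA'⟩ := exists_isAdmissible_trace_eq hT₁
  obtain ⟨D, hD, hD'⟩ := exists_isAdmissible_trace_eq hT₂
  obtain ⟨C, hC, hbound⟩ :=
    exists_abs_dotProduct_mulVec_le (hA.fromBlocks_zero hD).1 (fromBlocks 0 W Wᵀ 0)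
  set ε : ℝ := (2 * C)⁻¹ with hε
  have hεpos : 0 < ε := by positivity
  have hadm : IsAdmissible (fromBlocks A (-ε • W) (-ε • W)ᵀ D) := by
    refine hA.fromBlocks hD fun a b => ?_
    have hab := hbound (Sum.elim a b)
    rw [elim_dotProduct_fromBlocks_mulVec, elim_dotProduct_fromBlocks_mulVec] at hab
    simp only [zero_mulVec, dotProduct_zero, zero_add, mul_zero, add_zero] at hab
    rw [smul_mulVec, dotProduct_smul, smul_eq_mul, mul_left_comm, abs_mul, abs_neg,
      abs_of_pos hεpos]
    refine (mul_le_mul_of_nonneg_left hab hεpos.le).trans_eq ?_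
    rw [hε]
    field_simp
  have hle := dyadicTrace_le_trace hT.posSemidef hadm
  rw [trace_fromBlocks_mul_fromBlocks, hA', hD', h, smul_mul, trace_smul, smul_eq_mul] at hle
  have hWpos : 0 ≤ (W * Wᴴ).trace := (posSemidef_self_mul_conjTranspose W).trace_nonneg
  have hWW : (W * Wᴴ).trace = 0 := by
    rw [conjTranspose_eq_transpose_of_trivial] at hWpos ⊢
    nlinarith
  exact trace_mul_conjTranspose_self_eq_zero_iff.mp hWW

end blocks

/-- Equality case of subadditivity of the dyadic trace across block decompositions:
for positive definite rational `T = [[T₁, W],[Wᵀ, T₂]]` one has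
`w(T) = w(T₁) + w(T₂)` if and only if `W = 0`. -/
theorem dyadicTrace_block_eq_iff {g₁ g₂ : ℕ} (hg₁ : 1 ≤ g₁) (hg₂ : 1 ≤ g₂)
    (T₁ : Matrix (Fin g₁) (Fin g₁) ℝ) (T₂ : Matrix (Fin g₂) (Fin g₂) ℝ)
    (W : Matrix (Fin g₁) (Fin g₂) ℝ)
    (hQ₁ : RationalEntries T₁) (hQ₂ : RationalEntries T₂)
    (hQW : ∀ i j, ∃ q : ℚ, W i j = (q : ℝ))
    (hT₁ : T₁.PosDef) (hT₂ : T₂.PosDef)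
    (hT : (Matrix.fromBlocks T₁ W Wᵀ T₂).PosDef) :
    dyadicTrace (Matrix.fromBlocks T₁ W Wᵀ T₂) = dyadicTrace T₁ + dyadicTrace T₂ ↔
      W = 0 := by
  have : Nonempty (Fin g₁) := ⟨⟨0, hg₁⟩⟩
  have : Nonempty (Fin g₂) := ⟨⟨0, hg₂⟩⟩
  refine ⟨eq_zero_of_dyadicTrace_fromBlocks_eq hT₁ hT₂ hT, ?_⟩
  rintro rfl
  exact dyadicTrace_fromBlocks_zero hT₁ hT₂ hT
end

section
/- The right action of Δ_g(ℤ) = {γ ∈ Sp(2g,ℤ) : C = 0} on the set of even characteristics in 𝔽₂^{2g} (restricted from the Sp(2g,ℤ)-action ζ·γ = γᵀζ + ε(γ)) has exactly two orbits: the set {[0;b] : b ∈ 𝔽₂^g} of size 2^g, and the set of even characteristics [a;b] with a ≠ 0, of size 2^{g-1}(2^g - 1). -/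
open Matrix

/-- The diagonal-shift characteristic `ε(γ) = [(AᵀC)₀ ; (BᵀD)₀]` (mod 2). -/
def epsChar {g : ℕ} (γ : Matrix (Fin g ⊕ Fin g) (Fin g ⊕ Fin g) ℤ) :
    (Fin g ⊕ Fin g) → ZMod 2 :=
  Sum.elim (fun i => (((γ.toBlocks₁₁)ᵀ * γ.toBlocks₂₁).diag i : ZMod 2))
    (fun i => (((γ.toBlocks₁₂)ᵀ * γ.toBlocks₂₂).diag i : ZMod 2))

/-- The affine action `ζ · γ = γᵀ ζ + ε(γ)` of `Sp(2g, ℤ)` on characteristics. -/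
def charAct {g : ℕ} (γ : Matrix (Fin g ⊕ Fin g) (Fin g ⊕ Fin g) ℤ)
    (ζ : (Fin g ⊕ Fin g) → ZMod 2) : (Fin g ⊕ Fin g) → ZMod 2 :=
  (γ.map (Int.cast : ℤ → ZMod 2))ᵀ.mulVec ζ + epsChar γ

/-- The Siegel parabolic `Δ_g(ℤ)`: integral symplectic matrices with `C = 0`. -/
def siegelParabolicSet (g : ℕ) : Set (Matrix (Fin g ⊕ Fin g) (Fin g ⊕ Fin g) ℤ) :=
  {γ | γ ∈ Matrix.symplecticGroup (Fin g) ℤ ∧ γ.toBlocks₂₁ = 0}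

/-- A characteristic `ζ = [a;b]` is even if `a · b = 0` in `𝔽₂`. -/
def IsEvenChar {g : ℕ} (ζ : (Fin g ⊕ Fin g) → ZMod 2) : Prop :=
  (fun i => ζ (Sum.inl i)) ⬝ᵥ (fun i => ζ (Sum.inr i)) = 0

theorem ZMod.dotProduct_mulVec_self_add_diag {n : Type*} [Fintype n] [DecidableEq n]
    {S : Matrix n n (ZMod 2)} (hS : S.IsSymm) (v : n → ZMod 2) :
    v ⬝ᵥ (S *ᵥ v + S.diag) = 0 := by
  have key : v ⬝ᵥ (S *ᵥ v + S.diag) =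
      ∑ p : n × n, (v p.1 * (S p.1 p.2 * v p.2) + if p.1 = p.2 then v p.1 * S p.1 p.1 else 0) := by
    rw [Fintype.sum_prod_type]
    refine Finset.sum_congr rfl fun i _ => ?_
    simp [Finset.sum_add_distrib, mulVec, dotProduct, mul_add, Finset.mul_sum]
  rw [key]
  refine Finset.sum_involution (fun p _ => p.swap) ?_ ?_ (by simp) (by simp)
  · rintro ⟨i, j⟩ -
    have h2 : ∀ x : ZMod 2, x + x = 0 := by decide
    have h := hS.apply i j
    by_cases hij : i = j
    · subst hij; simp [h2]
    · simp only [Prod.swap, hij, Ne.symm hij, if_false, add_zero, h]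
      rw [show v j * (S i j * v i) = v i * (S i j * v j) by ring, h2]
  · rintro ⟨i, j⟩ - hne heq
    have hji : j = i := congrArg Prod.fst heq
    subst hji
    apply hne
    have h2 : ∀ x y : ZMod 2, x * (y * x) + x * y = 0 := by decide
    simpa using h2 _ _

theorem fromBlocks_mem_symplecticGroup {l : Type*} [Fintype l] [DecidableEq l]
    {A B D : Matrix l l ℤ} :
    fromBlocks A B 0 D ∈ symplecticGroup l ℤ ↔ Aᵀ * D = 1 ∧ (Bᵀ * D).IsSymm := by
  rw [SymplecticGroup.mem_iff', J, fromBlocks_transpose, fromBlocks_multiply, fromBlocks_multiply,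
    fromBlocks_inj, IsSymm, transpose_mul, transpose_transpose]
  simp only [transpose_zero, Matrix.mul_zero, Matrix.zero_mul, Matrix.mul_one, Matrix.mul_neg,
    Matrix.neg_mul, neg_inj, add_zero, zero_add, true_and]
  constructor
  · rintro ⟨h, -, h'⟩
    exact ⟨h, add_neg_eq_zero.1 h'⟩
  · rintro ⟨h, h'⟩
    refine ⟨h, ?_, by rw [h', add_neg_cancel]⟩
    simpa using congrArg transpose h

theorem charAct_fromBlocks {g : ℕ} (A B D : Matrix (Fin g) (Fin g) ℤ) (a b : Fin g → ZMod 2) :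
    charAct (fromBlocks A B 0 D) (Sum.elim a b) =
      Sum.elim ((A.map (Int.cast : ℤ → ZMod 2))ᵀ *ᵥ a)
        ((B.map (Int.cast : ℤ → ZMod 2))ᵀ *ᵥ a + (D.map (Int.cast : ℤ → ZMod 2))ᵀ *ᵥ b +
          ((Bᵀ * D).map (Int.cast : ℤ → ZMod 2)).diag) := by
  rw [charAct, epsChar, fromBlocks_map, fromBlocks_transpose, fromBlocks_mulVec]
  ext (i | i) <;> simp [Function.comp_def]

theorem map_intCast_mul {l : Type*} [Fintype l] (M N : Matrix l l ℤ) :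
    (M * N).map (Int.cast : ℤ → ZMod 2) = M.map Int.cast * N.map Int.cast :=
  Matrix.map_mul (f := Int.castRingHom (ZMod 2))

theorem map_intCast_one {l : Type*} [DecidableEq l] :
    (1 : Matrix l l ℤ).map (Int.cast : ℤ → ZMod 2) = 1 :=
  Matrix.map_one _ Int.cast_zero Int.cast_one

/-- The matrix `[[A, AS], [0, A⁻ᵀ]]`, for `N = A⁻¹` and `S` symmetric, lies in the Siegel parabolic. -/
theorem fromBlocks_mem_siegelParabolicSet {g : ℕ} {A N S : Matrix (Fin g) (Fin g) ℤ}
    (hN : N * A = 1) (hS : S.IsSymm) :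
    fromBlocks A (A * S) 0 Nᵀ ∈ siegelParabolicSet g := by
  have h : Aᵀ * Nᵀ = 1 := by rw [← transpose_mul, hN, transpose_one]
  refine ⟨fromBlocks_mem_symplecticGroup.2 ⟨h, ?_⟩, toBlocks_fromBlocks₂₁ ..⟩
  rw [transpose_mul, Matrix.mul_assoc, h, Matrix.mul_one, hS.eq]
  exact hS

theorem charAct_fromBlocks_mul {g : ℕ} {A N S : Matrix (Fin g) (Fin g) ℤ}
    (hN : N * A = 1) (hS : S.IsSymm) (a b : Fin g → ZMod 2) :
    charAct (fromBlocks A (A * S) 0 Nᵀ) (Sum.elim a b) =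
      Sum.elim ((A.map (Int.cast : ℤ → ZMod 2))ᵀ *ᵥ a)
        (S.map (Int.cast : ℤ → ZMod 2) *ᵥ ((A.map (Int.cast : ℤ → ZMod 2))ᵀ *ᵥ a) +
          N.map (Int.cast : ℤ → ZMod 2) *ᵥ b + (S.map (Int.cast : ℤ → ZMod 2)).diag) := by
  have h : Aᵀ * Nᵀ = 1 := by rw [← transpose_mul, hN, transpose_one]
  rw [charAct_fromBlocks, transpose_mul, Matrix.mul_assoc, h, Matrix.mul_one, hS.eq,
    map_intCast_mul, transpose_mul, ← mulVec_mulVec, (hS.map _).eq, transpose_map,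
    transpose_transpose]

/-- Every vector over `ZMod 2` moves to any other one sharing a nonzero coordinate with it
by an integral transvection. -/
theorem exists_mul_eq_one_mulVec_eq_of_apply {g : ℕ} {a a' : Fin g → ZMod 2} {i : Fin g}
    (h : a i = 1) (h' : a' i = 1) :
    ∃ M N : Matrix (Fin g) (Fin g) ℤ, M * N = 1 ∧ M.map (Int.cast : ℤ → ZMod 2) *ᵥ a = a' := by
  set u : Fin g → ℤ := fun j => ((a' j - a j).val : ℤ) with hu
  have hui : u i = 0 := by simp [hu, h, h']
  refine ⟨1 + vecMulVec u (Pi.single i 1), 1 - vecMulVec u (Pi.single i 1), ?_, ?_⟩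
  · have : vecMulVec u (Pi.single i 1) * vecMulVec u (Pi.single i 1) = 0 := by
      rw [vecMulVec_mul_vecMulVec]
      simp [hui]
    rw [add_mul, mul_sub, mul_sub, this]
    simp
  · have : (1 + vecMulVec u (Pi.single i 1)).map (Int.cast : ℤ → ZMod 2) =
        1 + vecMulVec (a' - a) (Pi.single i 1) := by
      ext j k
      by_cases hk : k = i <;> by_cases hj : j = k <;>
        simp [vecMulVec_apply, hu, one_apply, hk, hj]
    rw [this, add_mulVec, one_mulVec, vecMulVec_mulVec]
    ext j
    simp [h]

theorem exists_mul_eq_one_mulVec_eq {g : ℕ} {a a' : Fin g → ZMod 2} (h : a ≠ 0) (h' : a' ≠ 0) :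
    ∃ M N : Matrix (Fin g) (Fin g) ℤ, M * N = 1 ∧ M.map (Int.cast : ℤ → ZMod 2) *ᵥ a = a' := by
  have h01 : ∀ x : ZMod 2, x ≠ 0 → x = 1 := by decide
  obtain ⟨i, hi⟩ := Function.ne_iff.1 h
  obtain ⟨j, hj⟩ := Function.ne_iff.1 h'
  replace hi := h01 _ hi
  replace hj := h01 _ hj
  by_cases hi' : a' i = 0
  · by_cases hj' : a j = 0
    · obtain ⟨M, N, hMN, hM⟩ := exists_mul_eq_one_mulVec_eq_of_apply (a := a) (a' := a + a')
        (i := i) hi (by simp [hi, hi'])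
      obtain ⟨P, Q, hPQ, hP⟩ := exists_mul_eq_one_mulVec_eq_of_apply (a := a + a') (a' := a')
        (i := j) (by simp [hj, hj']) hj
      refine ⟨P * M, N * Q, ?_, ?_⟩
      · rw [Matrix.mul_assoc, ← Matrix.mul_assoc M, hMN, Matrix.one_mul, hPQ]
      · rw [map_intCast_mul, ← mulVec_mulVec, hM, hP]
    · exact exists_mul_eq_one_mulVec_eq_of_apply (h01 _ hj') hj
  · exact exists_mul_eq_one_mulVec_eq_of_apply hi (h01 _ hi')

theorem card_dotProduct_eq_zero {g : ℕ} {a : Fin g → ZMod 2} (ha : a ≠ 0) :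
    Nat.card {b : Fin g → ZMod 2 // a ⬝ᵥ b = 0} = 2 ^ (g - 1) := by
  set f : Module.Dual (ZMod 2) (Fin g → ZMod 2) := dotProductBilin (ZMod 2) (ZMod 2) a with hf
  have hne : f ≠ 0 := fun h0 => ha <| dotProduct_eq_zero a fun w => LinearMap.congr_fun h0 w
  have hk := Module.Dual.finrank_ker_add_one_of_ne_zero hne
  rw [Module.finrank_fin_fun] at hk
  have := Module.natCard_eq_pow_finrank (K := ZMod 2) (V := LinearMap.ker f)
  rw [Nat.card_zmod, show Module.finrank (ZMod 2) (LinearMap.ker f) = g - 1 by omega] at this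
  exact this

theorem card_isEvenChar_ne_zero (g : ℕ) :
    Nat.card {ζ : (Fin g ⊕ Fin g) → ZMod 2 //
      IsEvenChar ζ ∧ ¬ (∀ i, ζ (Sum.inl i) = 0)} = 2 ^ (g - 1) * (2 ^ g - 1) := by
  let e : {ζ : (Fin g ⊕ Fin g) → ZMod 2 // IsEvenChar ζ ∧ ¬ (∀ i, ζ (Sum.inl i) = 0)} ≃
      Σ a : {a : Fin g → ZMod 2 // a ≠ 0}, {b : Fin g → ZMod 2 // a.1 ⬝ᵥ b = 0} :=
    { toFun ζ := ⟨⟨fun i => ζ.1 (Sum.inl i), fun h => ζ.2.2 (congrFun h)⟩,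
        ⟨fun i => ζ.1 (Sum.inr i), ζ.2.1⟩⟩
      invFun p := ⟨Sum.elim p.1.1 p.2.1, p.2.2, fun h => p.1.2 (funext h)⟩
      left_inv ζ := Subtype.ext (by ext (i | i) <;> rfl)
      right_inv _ := rfl }
  rw [Nat.card_congr e, Nat.card_sigma,
    Finset.sum_congr rfl fun a _ => card_dotProduct_eq_zero a.2]
  simp [mul_comm, Fintype.card_subtype_compl]

/-- The restriction to `Δ_g(ℤ)` of the `Sp(2g,ℤ)`-action on even characteristics
has exactly two orbits: `{[0;b]}`, of size `2^g`, and the even characteristics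
with `a ≠ 0`, of size `2^{g-1}(2^g - 1)`. -/
theorem siegelParabolic_orbits_on_even_chars {g : ℕ} (hg : 1 ≤ g) :
    (∀ γ ∈ siegelParabolicSet g, ∀ ζ : (Fin g ⊕ Fin g) → ZMod 2, IsEvenChar ζ →
      IsEvenChar (charAct γ ζ) ∧
      ((∀ i, ζ (Sum.inl i) = 0) ↔ ∀ i, charAct γ ζ (Sum.inl i) = 0)) ∧
    (∀ ζ ζ' : (Fin g ⊕ Fin g) → ZMod 2, IsEvenChar ζ → IsEvenChar ζ' →
      (∀ i, ζ (Sum.inl i) = 0) → (∀ i, ζ' (Sum.inl i) = 0) →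
      ∃ γ ∈ siegelParabolicSet g, charAct γ ζ = ζ') ∧
    (∀ ζ ζ' : (Fin g ⊕ Fin g) → ZMod 2, IsEvenChar ζ → IsEvenChar ζ' →
      ¬ (∀ i, ζ (Sum.inl i) = 0) → ¬ (∀ i, ζ' (Sum.inl i) = 0) →
      ∃ γ ∈ siegelParabolicSet g, charAct γ ζ = ζ') ∧
    Nat.card {ζ : (Fin g ⊕ Fin g) → ZMod 2 // ∀ i, ζ (Sum.inl i) = 0} = 2 ^ g ∧
    Nat.card {ζ : (Fin g ⊕ Fin g) → ZMod 2 //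
      IsEvenChar ζ ∧ ¬ (∀ i, ζ (Sum.inl i) = 0)} = 2 ^ (g - 1) * (2 ^ g - 1) := by
  have key : ∀ ζ : (Fin g ⊕ Fin g) → ZMod 2,
      ζ = Sum.elim (fun i => ζ (Sum.inl i)) (fun i => ζ (Sum.inr i)) :=
    fun ζ => by ext (i | i) <;> rfl
  refine ⟨?_, ?_, ?_, ?_, card_isEvenChar_ne_zero g⟩
  · rintro γ ⟨hγ, hC⟩ ζ hζ
    obtain ⟨a, b, rfl⟩ : ∃ a b, ζ = Sum.elim a b := ⟨_, _, key ζ⟩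
    change a ⬝ᵥ b = 0 at hζ
    obtain ⟨A, B, D, rfl⟩ : ∃ A B D, γ = fromBlocks A B 0 D :=
      ⟨_, _, _, by rw [← hC, fromBlocks_toBlocks]⟩
    obtain ⟨hAD, hBD⟩ := fromBlocks_mem_symplecticGroup.1 hγ
    have hDA : (D.map (Int.cast : ℤ → ZMod 2)) * (A.map (Int.cast : ℤ → ZMod 2))ᵀ = 1 := by
      rw [← transpose_map, ← map_intCast_mul, mul_eq_one_comm.1 hAD, map_intCast_one]
    have hB : (B.map (Int.cast : ℤ → ZMod 2))ᵀ =
        (Bᵀ * D).map (Int.cast : ℤ → ZMod 2) * (A.map (Int.cast : ℤ → ZMod 2))ᵀ := by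
      rw [map_intCast_mul, Matrix.mul_assoc, hDA, Matrix.mul_one, transpose_map]
    rw [charAct_fromBlocks]
    refine ⟨?_, fun h => ?_, fun h => ?_⟩
    · change _ ⬝ᵥ _ = _
      simp only [Sum.elim_inl, Sum.elim_inr]
      change ((A.map (Int.cast : ℤ → ZMod 2))ᵀ *ᵥ a) ⬝ᵥ _ = 0
      have h1 := ZMod.dotProduct_mulVec_self_add_diag (hBD.map (Int.cast : ℤ → ZMod 2))
        ((A.map (Int.cast : ℤ → ZMod 2))ᵀ *ᵥ a)
      have h2 : ((A.map (Int.cast : ℤ → ZMod 2))ᵀ *ᵥ a) ⬝ᵥ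
          ((D.map (Int.cast : ℤ → ZMod 2))ᵀ *ᵥ b) = 0 := by
        rw [dotProduct_mulVec, vecMul_transpose, mulVec_mulVec, hDA, one_mulVec, hζ]
      rw [mulVec_mulVec, ← hB, dotProduct_add] at h1
      change _ ⬝ᵥ (_ + _ + _) = _
      rw [dotProduct_add, dotProduct_add, h2, add_zero, h1]
    · obtain rfl : a = 0 := funext h
      simp
    · have h0 : (A.map (Int.cast : ℤ → ZMod 2))ᵀ *ᵥ a = 0 := funext h
      have : a = 0 := by
        rw [← one_mulVec a, ← hDA, ← mulVec_mulVec, h0, mulVec_zero]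
      simp [this]
  · intro ζ ζ' _ _ h h'
    obtain ⟨a, b, rfl⟩ : ∃ a b, ζ = Sum.elim a b := ⟨_, _, key ζ⟩
    obtain ⟨a', b', rfl⟩ : ∃ a b, ζ' = Sum.elim a b := ⟨_, _, key ζ'⟩
    obtain rfl : a = 0 := funext h
    obtain rfl : a' = 0 := funext h'
    have hS : (diagonal fun i => ((b' i - b i).val : ℤ)).IsSymm := isSymm_diagonal _
    refine ⟨_, fromBlocks_mem_siegelParabolicSet (Matrix.one_mul 1) hS, ?_⟩
    rw [charAct_fromBlocks_mul (Matrix.one_mul 1) hS]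
    simp only [mulVec_zero, map_intCast_one, one_mulVec, zero_add]
    congr 1
    ext i
    simp
  · intro ζ ζ' he he' h h'
    obtain ⟨a, b, rfl⟩ : ∃ a b, ζ = Sum.elim a b := ⟨_, _, key ζ⟩
    obtain ⟨a', b', rfl⟩ : ∃ a b, ζ' = Sum.elim a b := ⟨_, _, key ζ'⟩
    change a ⬝ᵥ b = 0 at he
    change a' ⬝ᵥ b' = 0 at he'
    have ha : a ≠ 0 := fun h0 => h (congrFun h0)
    have ha' : a' ≠ 0 := fun h0 => h' (congrFun h0)
    obtain ⟨M, N, hMN, hM⟩ := exists_mul_eq_one_mulVec_eq ha ha'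
    have hN : Nᵀ * Mᵀ = 1 := by rw [← transpose_mul, hMN, transpose_one]
    obtain ⟨i, hi⟩ := Function.ne_iff.1 ha'
    replace hi : a' i = 1 := (by decide : ∀ x : ZMod 2, x ≠ 0 → x = 1) _ hi
    set c : Fin g → ZMod 2 := b' - Nᵀ.map (Int.cast : ℤ → ZMod 2) *ᵥ b with hc
    have hca : c ⬝ᵥ a' = 0 := by
      have : (Nᵀ.map (Int.cast : ℤ → ZMod 2) *ᵥ b) ⬝ᵥ a' = 0 := by
        rw [← hM, dotProduct_mulVec, transpose_map, mulVec_transpose, vecMul_vecMul,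
          ← map_intCast_mul, mul_eq_one_comm.1 hMN, map_intCast_one, vecMul_one,
          dotProduct_comm, he]
      rw [hc, sub_dotProduct, this, dotProduct_comm, he', sub_zero]
    set S : Matrix (Fin g) (Fin g) ℤ :=
      vecMulVec (fun j => ((c j).val : ℤ)) (Pi.single i 1) +
        vecMulVec (Pi.single i 1) (fun j => ((c j).val : ℤ)) with hSdef
    have hS : S.IsSymm := by
      rw [IsSymm, hSdef, transpose_add, transpose_vecMulVec, transpose_vecMulVec, add_comm]
    have hScast : S.map (Int.cast : ℤ → ZMod 2) =
        vecMulVec c (Pi.single i 1) + vecMulVec (Pi.single i 1) c := by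
      ext j k
      by_cases hk : k = i <;> by_cases hj : j = i <;>
        simp [hSdef, vecMulVec_apply, hk, hj]
    refine ⟨_, fromBlocks_mem_siegelParabolicSet hN hS, ?_⟩
    rw [charAct_fromBlocks_mul hN hS, transpose_map, transpose_transpose, hM, hScast]
    congr 1
    have hdiag : (vecMulVec c (Pi.single i 1) + vecMulVec (Pi.single i 1) c).diag = 0 := by
      ext j
      simp only [diag_apply, Matrix.add_apply, vecMulVec_apply, Pi.zero_apply]
      rw [mul_comm (c j)]
      exact CharTwo.add_self_eq_zero _
    rw [hdiag, add_mulVec, vecMulVec_mulVec, vecMulVec_mulVec, hca, single_one_dotProduct, hi]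
    simp [hc]
  · let e : {ζ : (Fin g ⊕ Fin g) → ZMod 2 // ∀ i, ζ (Sum.inl i) = 0} ≃ (Fin g → ZMod 2) :=
      { toFun ζ i := ζ.1 (Sum.inr i)
        invFun b := ⟨Sum.elim 0 b, fun _ => rfl⟩
        left_inv ζ := Subtype.ext (by
          ext (i | i)
          · exact (ζ.2 i).symm
          · rfl)
        right_inv _ := rfl }
    rw [Nat.card_congr e]
    simp
end
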